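/- arXiv:1703.05391 — 2 statements merged into one kernel-verified Lean document; each statement's English description precedes it below -/
import Mathlib

section
/- The reduced symmetrized topological complexity of the circle equals 2: the minimal number of symmetric open subsets of S¹×S¹ that cover S¹×S¹ and each admit a symmetric motion planning rule is exactly 3. -/
open unitInterval

/-- A subset of `S¹ × S¹` is symmetric if `(x, y) ∈ V` implies `(y, x) ∈ V`. -/
def IsSymmetricSet (V : Set (Circle × Circle)) : Prop :=
  ∀ x y : Circle, (x, y) ∈ V → (y, x) ∈ V

/-- `s` is a symmetric motion planning rule on `V ⊆ S¹ × S¹`: a continuous map from `V`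
to the path space `C(I, S¹) = PS¹` (carrying the compact-open topology), sending each
`(x, y) ∈ V` to a path from `x` to `y`, such that `s (y, x)` is the time-reversal of
`s (x, y)`. -/
def IsSymmetricMPR (V : Set (Circle × Circle)) (s : V → C(unitInterval, Circle)) : Prop :=
  Continuous s ∧
  (∀ p : V, s p 0 = p.1.1 ∧ s p 1 = p.1.2) ∧
  (∀ (x y : Circle) (hxy : (x, y) ∈ V) (hyx : (y, x) ∈ V) (t : unitInterval),
    s ⟨(y, x), hyx⟩ t = s ⟨(x, y), hxy⟩ (σ t))

open Real

/-- A continuous antisymmetric choice of angle from `x` to `y`, for `(x, y) ∈ V`. -/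
structure IsAntisymmetricAngle (V : Set (Circle × Circle)) (d : Circle × Circle → ℝ) : Prop where
  continuousOn : ContinuousOn d V
  exp_mul : ∀ p ∈ V, p.1 * Circle.exp (d p) = p.2
  swap : ∀ p ∈ V, d p.swap = -d p

/-- Rotating at constant speed through an antisymmetric angle is a symmetric motion planning
rule. -/
theorem IsAntisymmetricAngle.exists_isSymmetricMPR {V : Set (Circle × Circle)}
    {d : Circle × Circle → ℝ} (hd : IsAntisymmetricAngle V d) :
    ∃ s : V → C(unitInterval, Circle), IsSymmetricMPR V s := by
  have hdV : Continuous fun p : V => d p := hd.continuousOn.domRestrict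
  let H : C(V × unitInterval, Circle) :=
    ⟨fun q => q.1.1.1 * Circle.exp (q.2 * d q.1),
      (continuous_fst.comp (continuous_subtype_val.comp continuous_fst)).mul
        (Circle.exp.continuous.comp
          ((continuous_subtype_val.comp continuous_snd).mul (hdV.comp continuous_fst)))⟩
  refine ⟨H.curry, H.curry.continuous, fun p => ⟨?_, ?_⟩, fun x y hxy hyx t => ?_⟩
  · simp [H]
  · simpa [H] using hd.exp_mul p p.2
  · have hs : d (y, x) = -d (x, y) := hd.swap _ hxy
    have hy : x * Circle.exp (d (x, y)) = y := hd.exp_mul _ hxy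
    change y * Circle.exp (t * d (y, x)) = x * Circle.exp ((σ t : ℝ) * d (x, y))
    rw [hs]
    nth_rw 1 [← hy]
    rw [mul_assoc, ← Circle.exp_add, unitInterval.coe_symm_eq]
    congr 2
    ring

/-- Lifting the paths of a symmetric motion planning rule to `ℝ` yields an antisymmetric angle. -/
theorem IsSymmetricMPR.exists_isAntisymmetricAngle {V : Set (Circle × Circle)}
    (hV : IsSymmetricSet V) {s : V → C(unitInterval, Circle)} (hs : IsSymmetricMPR V s) :
    ∃ d, IsAntisymmetricAngle V d := by
  classical
  obtain ⟨hc, hend, hsymm⟩ := hs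
  have hc' : Continuous fun q : unitInterval × V => s q.2 q.1 := by fun_prop
  let H : C(unitInterval × V, Circle) := ⟨fun q => s q.2 q.1 / q.2.1.1, by fun_prop⟩
  have H0 : ∀ p : V, H (0, p) = Circle.exp ((0 : C(V, ℝ)) p) := fun p => by
    simp [H, (hend p).1]
  let L := Circle.isCoveringMap_exp.liftHomotopy H 0 H0
  have hL (t : unitInterval) (p : V) : Circle.exp (L (t, p)) = s p t / p.1.1 :=
    congrFun (Circle.isCoveringMap_exp.liftHomotopy_lifts H 0 H0) (t, p)
  have hL0 (p : V) : L (0, p) = 0 := Circle.isCoveringMap_exp.liftHomotopy_zero H 0 H0 p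
  refine ⟨fun p => if h : p ∈ V then L (1, ⟨p, h⟩) else 0, ?_, fun p hp => ?_, fun p hp => ?_⟩
  · rw [continuousOn_iff_continuous_domRestrict]
    have : Continuous fun p : V => L (1, p) := by fun_prop
    convert this using 2 with p
    simp
  · simp [hp, hL, (hend _).2]
  · have hp' : p.swap ∈ V := hV _ _ hp
    simp only [hp, hp', dite_true]
    have key : (fun t => L (t, ⟨p, hp⟩)) =
        fun t => L (σ t, ⟨p.swap, hp'⟩) - L (1, ⟨p.swap, hp'⟩) := by
      refine Circle.isCoveringMap_exp.eq_of_comp_eq (by fun_prop) (by fun_prop) ?_ 0 ?_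
      · funext t
        have h1 : s ⟨p.swap, hp'⟩ (σ t) = s ⟨p, hp⟩ t := by
          have := hsymm p.1 p.2 hp hp' (σ t)
          rwa [unitInterval.symm_symm] at this
        simp [hL, Circle.exp_sub, h1, (hend _).2]
      · simp [hL0]
    have := congrFun key 1
    simp only [unitInterval.symm_one, hL0] at this
    linarith

theorem Complex.arg_inv_of_mem_slitPlane {z : ℂ} (hz : z ∈ Complex.slitPlane) :
    Complex.arg z⁻¹ = -Complex.arg z := by
  rw [Complex.arg_inv, if_neg (Complex.mem_slitPlane_iff_arg.1 hz).1]

theorem Complex.inv_mem_slitPlane_of_mem {z : ℂ} (hz : z ∈ Complex.slitPlane) :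
    z⁻¹ ∈ Complex.slitPlane := by
  have h := Complex.mem_slitPlane_iff_arg.1 hz
  refine Complex.mem_slitPlane_iff_arg.2 ⟨?_, inv_ne_zero h.2⟩
  rw [Complex.arg_inv_of_mem_slitPlane hz]
  linarith [Complex.neg_pi_lt_arg z, Real.pi_pos, (Complex.arg_le_pi z).lt_of_ne h.1]

theorem Complex.neg_mem_slitPlane_of_notMem {z : ℂ} (hz : z ≠ 0) (h : z ∉ Complex.slitPlane) :
    -z ∈ Complex.slitPlane := by
  rw [Complex.mem_slitPlane_iff] at h ⊢
  push Not at h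
  refine Or.inl ?_
  rw [Complex.neg_re, neg_pos]
  exact h.1.lt_of_ne fun h' => hz (Complex.ext h' h.2)

/-- The set of pairs of points of the circle which are not antipodal. -/
def nonAntipodalPairs : Set (Circle × Circle) :=
  {p | (p.2 / p.1 : ℂ) ∈ Complex.slitPlane}

theorem continuous_circle_div : Continuous fun p : Circle × Circle => (p.2 / p.1 : ℂ) :=
  Continuous.div (by fun_prop) (by fun_prop) fun p => p.1.coe_ne_zero

theorem isOpen_nonAntipodalPairs : IsOpen nonAntipodalPairs :=
  Complex.isOpen_slitPlane.preimage continuous_circle_div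

theorem isSymmetricSet_nonAntipodalPairs : IsSymmetricSet nonAntipodalPairs := fun x y h => by
  simpa [nonAntipodalPairs] using Complex.inv_mem_slitPlane_of_mem h

theorem isAntisymmetricAngle_nonAntipodalPairs :
    IsAntisymmetricAngle nonAntipodalPairs fun p => Complex.arg (p.2 / p.1 : ℂ) where
  continuousOn p hp :=
    ((Complex.continuousAt_arg hp).comp (f := fun p : Circle × Circle => (p.2 / p.1 : ℂ))
      continuous_circle_div.continuousAt).continuousWithinAt
  exp_mul p _ := by
    rw [← Circle.coe_div, Circle.exp_arg, mul_div_cancel]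
  swap p hp := by
    simpa using Complex.arg_inv_of_mem_slitPlane hp

/-- The set of pairs of distinct points of the circle which are separated by `l`. -/
def separatedPairs (l : Circle → ℝ) : Set (Circle × Circle) :=
  {p | (-(p.2 / p.1) : ℂ) ∈ Complex.slitPlane ∧ l p.2 - l p.1 ≠ 0}

theorem isOpen_separatedPairs {l : Circle → ℝ} (hl : Continuous l) : IsOpen (separatedPairs l) :=
  (Complex.isOpen_slitPlane.preimage continuous_circle_div.neg).inter
    (isOpen_ne.preimage (by fun_prop : Continuous fun p : Circle × Circle => l p.2 - l p.1))

theorem isSymmetricSet_separatedPairs (l : Circle → ℝ) : IsSymmetricSet (separatedPairs l) :=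
  fun x y h => by
    refine ⟨?_, fun h' => h.2 (by dsimp only at h' ⊢; linarith)⟩
    simpa [inv_neg] using Complex.inv_mem_slitPlane_of_mem h.1

theorem isAntisymmetricAngle_separatedPairs {l : Circle → ℝ} (hl : Continuous l) :
    IsAntisymmetricAngle (separatedPairs l) fun p =>
      Complex.arg (-(p.2 / p.1) : ℂ) + π * ((l p.2 - l p.1) / |l p.2 - l p.1|) where
  continuousOn p hp := by
    have h1 : ContinuousAt (fun p : Circle × Circle => Complex.arg (-(p.2 / p.1) : ℂ)) p :=
      (Complex.continuousAt_arg hp.1).comp (f := fun p : Circle × Circle => (-(p.2 / p.1) : ℂ))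
        continuous_circle_div.neg.continuousAt
    have h2 : ContinuousAt (fun p : Circle × Circle => l p.2 - l p.1) p := by fun_prop
    exact (h1.add (continuousAt_const.mul
      (h2.div h2.abs (abs_ne_zero.2 hp.2)))).continuousWithinAt
  exp_mul p hp := by
    have h : ((Circle.exp (π * ((l p.2 - l p.1) / |l p.2 - l p.1|)) : Circle) : ℂ) = -1 := by
      rcases lt_or_gt_of_ne hp.2 with h | h
      · rw [abs_of_neg h, div_neg, div_self hp.2]
        simp [Circle.coe_exp]
      · rw [abs_of_pos h, div_self hp.2]
        simp [Circle.coe_exp]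
    have h' : ((Circle.exp (Complex.arg (-(p.2 / p.1) : ℂ)) : Circle) : ℂ) = -(p.2 / p.1) := by
      have := Complex.norm_mul_exp_arg_mul_I (-(p.2 / p.1) : ℂ)
      rw [norm_neg, norm_div, Circle.norm_coe, Circle.norm_coe] at this
      simpa [Circle.coe_exp] using this
    ext
    rw [Circle.exp_add, Circle.coe_mul, Circle.coe_mul, h, h']
    field_simp [p.1.coe_ne_zero]
  swap p hp := by
    have h := Complex.arg_inv_of_mem_slitPlane hp.1
    rw [inv_neg, inv_div] at h
    simp only [Prod.fst_swap, Prod.snd_swap, h, abs_sub_comm (l p.1)]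
    ring

/-- An antisymmetric angle `d` on `U` and a symmetric bump function `φ` supported in `U` yield an
odd function on the universal cover of the annulus. In the coordinates
`(a, θ) ↦ (exp (i a), exp (i (a + θ)))` it is built from the odd integer `(d - θ) / π + 1`. -/
theorem IsAntisymmetricAngle.exists_odd_extension {U : Set (Circle × Circle)} (hU : IsOpen U)
    {d : Circle × Circle → ℝ} (hd : IsAntisymmetricAngle U d)
    {φ : Circle × Circle → ℝ} (hφ : Continuous φ) (hφs : ∀ p, φ p.swap = φ p)
    (hφU : ∀ p, φ p ≠ 0 → p ∈ U) :
    ∃ G : ℝ × ℝ → ℝ, Continuous G ∧ (∀ a θ, G (a + θ, 2 * π - θ) = -G (a, θ)) ∧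
      (∀ a, G (a, 0) = φ (Circle.exp a, Circle.exp a)) ∧
      ∀ a θ, φ (Circle.exp a, Circle.exp (a + θ)) ≠ 0 → G (a, θ) ≠ 0 := by
  let c : ℝ → ℝ := fun r => max (-1) (min 1 r)
  have c_cont : Continuous c := by fun_prop
  have c_neg (r : ℝ) : c (-r) = -c r := by
    simp only [c]; grind
  have c_abs (r : ℝ) : |c r| ≤ 1 := by
    simp only [c]; grind
  have c_ne (r : ℝ) (h : r ≠ 0) : c r ≠ 0 := by
    simp only [c]; grind
  let P : ℝ × ℝ → Circle × Circle := fun q => (Circle.exp q.1, Circle.exp (q.1 + q.2))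
  have hP : Continuous P := by fun_prop
  let e : ℝ × ℝ → ℝ := fun q => (d (P q) - q.2) / π + 1
  have e_odd (q : ℝ × ℝ) (hq : P q ∈ U) : ∃ m : ℤ, e q = 2 * m + 1 := by
    have h := hd.exp_mul _ hq
    simp only [P, ← Circle.exp_add] at h
    obtain ⟨m, hm⟩ := Circle.exp_eq_exp.1 h
    refine ⟨m, ?_⟩
    simp only [e, P]
    have := pi_ne_zero
    field_simp
    linarith
  have P_swap (a θ : ℝ) : P (a + θ, 2 * π - θ) = (P (a, θ)).swap := by
    simp [P]
  have φ_zero (p) (h : p ∉ U) : φ p = 0 := by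
    by_contra h'
    exact h (hφU p h')
  refine ⟨fun q => φ (P q) * c (e q), ?_, fun a θ => ?_, fun a => ?_, fun a θ h => ?_⟩
  · rw [continuous_iff_continuousAt]
    intro q
    by_cases hq : P q ∈ U
    · have h1 : ContinuousAt d (P q) := hd.continuousOn.continuousAt (hU.mem_nhds hq)
      have h2 : ContinuousAt (fun q => d (P q)) q := h1.comp hP.continuousAt
      have h3 : ContinuousAt e q := by fun_prop
      fun_prop
    · have h0 := φ_zero _ hq
      have h1 : Filter.Tendsto (fun q => φ (P q)) (nhds q) (nhds 0) := by
        rw [← h0]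
        exact (hφ.comp hP).continuousAt
      have h2 := h1.zero_mul_isBoundedUnder_le (g := fun q => c (e q))
        (Filter.isBoundedUnder_of ⟨1, fun x => c_abs _⟩)
      simpa [ContinuousAt, h0] using h2
  · by_cases hq : P (a, θ) ∈ U
    · have : e (a + θ, 2 * π - θ) = -e (a, θ) := by
        simp only [e, P_swap, hd.swap _ hq]
        have := pi_ne_zero
        field_simp
        ring
      simp only [this, c_neg, P_swap, hφs]
      ring
    · simp [P_swap, hφs, φ_zero _ hq]
  · by_cases hq : P (a, 0) ∈ U
    · have hs : d (P (a, 0)) = 0 := by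
        have := hd.swap _ hq
        have h' : (P (a, 0)).swap = P (a, 0) := by simp [P]
        rw [h'] at this
        linarith
      have he : e (a, 0) = 1 := by simp [e, hs]
      simp [he, c, P]
    · have h0 := φ_zero _ hq
      simp only [h0]
      simp only [P, add_zero] at h0
      simp [h0]
  · obtain ⟨m, hm⟩ := e_odd (a, θ) (hφU _ h)
    refine mul_ne_zero h (c_ne _ ?_)
    rw [hm]
    norm_cast
    omega

theorem Complex.eq_of_exp_comp_eq {A : Type*} [TopologicalSpace A] [PreconnectedSpace A]
    {f g : A → ℂ} (hf : Continuous f) (hg : Continuous g)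
    (h : ∀ a, Complex.exp (f a) = Complex.exp (g a)) (a₀ : A) (h₀ : f a₀ = g a₀) : f = g :=
  Complex.isCoveringMap_exp.eq_of_comp_eq hf hg (funext fun a => Subtype.ext (h a)) a₀ h₀

/-- A variant of the two-dimensional Borsuk–Ulam theorem: the involution
`(a, θ) ↦ (a + θ, 2π - θ)` of the annulus `(ℝ / 2πℤ) × ℝ` admits no nowhere vanishing odd function
to the plane that is inessential along `θ = 0`. -/
theorem not_exists_odd_ne_zero (F : ℝ × ℝ → ℂ) (hF : Continuous F) (hF0 : ∀ q, F q ≠ 0)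
    (hodd : ∀ a θ, F (a + θ, 2 * π - θ) = -F (a, θ))
    (hslit : ∀ a, F (a, 0) ∈ Complex.slitPlane) : False := by
  obtain ⟨ψ, ⟨-, hψ⟩, -⟩ := Complex.isCoveringMapOn_exp.existsUnique_continuousMap_lifts
    ⟨F, hF⟩ (a₀ := (0, 0)) (Complex.exp_log (hF0 _)) hF0
  have hψ (q) : Complex.exp (ψ q) = F q := congrFun hψ q
  set c := ψ (0, 2 * π) - ψ (0, 0) with hc
  have hexpc : Complex.exp c = -1 := by
    have := hodd 0 0
    simp only [add_zero, sub_zero] at this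
    rw [hc, Complex.exp_sub, hψ, hψ, this, neg_div, div_self (hF0 _)]
  have hτ : (fun q : ℝ × ℝ => ψ (q.1 + q.2, 2 * π - q.2)) = fun q => ψ q + c := by
    refine Complex.eq_of_exp_comp_eq (by fun_prop) (by fun_prop) (fun q => ?_) (0, 0) ?_
    · rw [Complex.exp_add, hexpc, hψ, hψ, hodd]
      simp
    · simp [hc]
  have h1 := congrFun hτ (0, 0)
  have h2 := congrFun hτ (0, 2 * π)
  simp only [zero_add, sub_zero, sub_self] at h1 h2
  have hlog : (fun a : ℝ => ψ (a, 0)) =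
      fun a => Complex.log (F (a, 0)) + (ψ (0, 0) - Complex.log (F (0, 0))) := by
    have hl : Continuous fun a : ℝ => Complex.log (F (a, 0)) :=
      Continuous.clog (by fun_prop) hslit
    refine Complex.eq_of_exp_comp_eq (by fun_prop) (by fun_prop) (fun a => ?_) 0 (by ring)
    rw [Complex.exp_add, Complex.exp_sub, Complex.exp_log (hF0 _), Complex.exp_log (hF0 _),
      hψ, hψ, div_self (hF0 _), mul_one]
  have hper : F (2 * π, 0) = F (0, 0) := by
    have h3 := hodd 0 0
    have h4 := hodd 0 (2 * π)
    simp only [zero_add, sub_zero, sub_self] at h3 h4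
    rw [h4, h3, neg_neg]
  have h5 := congrFun hlog (2 * π)
  simp only [hper] at h5
  have hc0 : c = 0 := by linear_combination (h5 - h2 - h1) / 2
  rw [hc0, Complex.exp_zero] at hexpc
  norm_num at hexpc

/-- Two symmetric open sets with antisymmetric angles do not cover the torus. -/
theorem union_ne_univ_of_isAntisymmetricAngle {U W : Set (Circle × Circle)}
    (hU : IsOpen U) (hW : IsOpen W) (hUs : IsSymmetricSet U) (hWs : IsSymmetricSet W)
    {d d' : Circle × Circle → ℝ} (hd : IsAntisymmetricAngle U d)
    (hd' : IsAntisymmetricAngle W d') : U ∪ W ≠ Set.univ := by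
  intro hcov
  obtain ⟨f, hfU, hfW, hf⟩ := exists_continuous_zero_one_of_isClosed hU.isClosed_compl
    hW.isClosed_compl (by
      rwa [Set.disjoint_compl_right_iff_subset, Set.compl_subset_iff_union])
  let φ : Circle × Circle → ℝ := fun p => (f p + f p.swap) / 2
  have hφ : Continuous φ := by fun_prop
  have hφs (p) : φ p.swap = φ p := by simp [φ, add_comm]
  have hφ0 (p) : 0 ≤ φ p := by
    have := (hf p).1
    have := (hf p.swap).1
    simp only [φ]; linarith
  have hφ1 (p) : φ p ≤ 1 := by
    have := (hf p).2
    have := (hf p.swap).2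
    simp only [φ]; linarith
  have hφU (p) (h : φ p ≠ 0) : p ∈ U := by
    by_contra hp
    have hp' : p.swap ∉ U := fun h' => hp (hUs _ _ h')
    exact h (by simp [φ, hfU hp, hfU hp'])
  have hφW (p) (h : 1 - φ p ≠ 0) : p ∈ W := by
    by_contra hp
    have hp' : p.swap ∉ W := fun h' => hp (hWs _ _ h')
    exact h (by simp [φ, hfW hp, hfW hp'])
  obtain ⟨G, hG, hGodd, hG0, hGne⟩ := hd.exists_odd_extension hU hφ hφs hφU
  obtain ⟨K, hK, hKodd, hK0, hKne⟩ := hd'.exists_odd_extension hW (φ := fun p => 1 - φ p)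
    (by fun_prop) (by simp [hφs]) hφW
  refine not_exists_odd_ne_zero (fun q => ⟨G q, K q⟩) ?_ ?_ ?_ ?_
  · exact Complex.equivRealProdCLM.symm.continuous.comp (hG.prodMk hK)
  · rintro ⟨a, θ⟩ h
    rw [Complex.ext_iff] at h
    have h1 : φ (Circle.exp a, Circle.exp (a + θ)) = 0 := by
      by_contra h'
      exact hGne a θ h' h.1
    exact hKne a θ (by rw [h1]; norm_num) h.2
  · intro a θ
    simp [Complex.ext_iff, hGodd, hKodd]
  · intro a
    rw [Complex.mem_slitPlane_iff]
    simp only [hG0, hK0]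
    have := hφ0 (Circle.exp a, Circle.exp a)
    grind

/-- The reduced symmetrized topological complexity of the circle equals 2: the minimal
number of symmetric open subsets of `S¹ × S¹` covering `S¹ × S¹`, each admitting a
symmetric motion planning rule, is exactly 3. -/
theorem symmetrized_TC_circle_eq_two :
    IsLeast {n : ℕ | ∃ V : Fin n → Set (Circle × Circle),
      (⋃ i, V i) = Set.univ ∧
      ∀ i, IsOpen (V i) ∧ IsSymmetricSet (V i) ∧
        ∃ s : V i → C(unitInterval, Circle), IsSymmetricMPR (V i) s} 3 := by
  constructor
  · refine ⟨![nonAntipodalPairs, separatedPairs fun z => (z : ℂ).re,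
      separatedPairs fun z => (z : ℂ).im], ?_, ?_⟩
    · refine Set.eq_univ_of_forall fun p => ?_
      rw [Set.mem_iUnion]
      by_cases h : p ∈ nonAntipodalPairs
      · exact ⟨0, h⟩
      have hneg : (-(p.2 / p.1) : ℂ) ∈ Complex.slitPlane :=
        Complex.neg_mem_slitPlane_of_notMem (div_ne_zero p.2.coe_ne_zero p.1.coe_ne_zero) h
      by_cases hre : (p.2 : ℂ).re - (p.1 : ℂ).re = 0
      · refine ⟨2, hneg, fun him => h ?_⟩
        have heq : (p.2 : ℂ) = p.1 := Complex.ext (sub_eq_zero.1 hre) (sub_eq_zero.1 him)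
        simp [nonAntipodalPairs, heq]
      · exact ⟨1, hneg, hre⟩
    · have hre : Continuous fun z : Circle => (z : ℂ).re := by fun_prop
      have him : Continuous fun z : Circle => (z : ℂ).im := by fun_prop
      intro i
      fin_cases i
      · exact ⟨isOpen_nonAntipodalPairs, isSymmetricSet_nonAntipodalPairs,
          isAntisymmetricAngle_nonAntipodalPairs.exists_isSymmetricMPR⟩
      · exact ⟨isOpen_separatedPairs hre, isSymmetricSet_separatedPairs fun z => (z : ℂ).re,
          (isAntisymmetricAngle_separatedPairs hre).exists_isSymmetricMPR⟩
      · exact ⟨isOpen_separatedPairs him, isSymmetricSet_separatedPairs fun z => (z : ℂ).im,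
          (isAntisymmetricAngle_separatedPairs him).exists_isSymmetricMPR⟩
  · rintro n ⟨V, hV, hn⟩
    by_contra! hlt
    obtain ⟨i₀, -⟩ := Set.mem_iUnion.1 (hV ▸ Set.mem_univ ((1, 1) : Circle × Circle))
    have := i₀.isLt
    obtain ⟨i, j, hij⟩ : ∃ i j : Fin n, ∀ k, k = i ∨ k = j :=
      ⟨⟨0, by omega⟩, ⟨n - 1, by omega⟩, fun k => by simp only [Fin.ext_iff]; omega⟩
    obtain ⟨hUo, hUs, s, hs⟩ := hn i
    obtain ⟨hWo, hWs, t, ht⟩ := hn j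
    obtain ⟨d, hd⟩ := hs.exists_isAntisymmetricAngle hUs
    obtain ⟨d', hd'⟩ := ht.exists_isAntisymmetricAngle hWs
    refine union_ne_univ_of_isAntisymmetricAngle hUo hWo hUs hWs hd hd' ?_
    refine Set.eq_univ_of_forall fun p => ?_
    obtain ⟨k, hk⟩ := Set.mem_iUnion.1 (hV ▸ Set.mem_univ p)
    rcases hij k with rfl | rfl
    · exact Or.inl hk
    · exact Or.inr hk
end

section
/- Let U be a connected subset of the square I² = [0,1]×[0,1] which is open in the subspace topology of I² and which intersects the topological boundary ∂I² of the square. Let P and Q be distinct points of the boundary, taken inside the space ∂I², of the set U ∩ ∂I², and let B and B' be the two connected components of ∂I² − {P,Q}. If B ∩ U = ∅, then there is a connected subset of ∂U − (B' ∩ ∂U) which contains both P and Q, where ∂U denotes the boundary of U in ℝ². -/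
/-- The unit square `I² = [0,1] × [0,1]` as a subset of `ℝ²`. -/
def unitSquare : Set (ℝ × ℝ) := Set.Icc (0 : ℝ) 1 ×ˢ Set.Icc (0 : ℝ) 1

open Set Topology

/-- Two continuous logarithms of the same function differ by a constant on a preconnected set. -/
theorem sub_eq_sub_of_exp_eq {Y : Type*} [TopologicalSpace Y] {S : Set Y} (hS : IsPreconnected S)
    {g h : Y → ℂ} (hg : ContinuousOn g S) (hh : ContinuousOn h S) {c : ℂ}
    (hgh : ∀ y ∈ S, Complex.exp (g y) = c * Complex.exp (h y)) {x y : Y} (hx : x ∈ S)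
    (hy : y ∈ S) : g y - g x = h y - h x := by
  have key : S.EqOn g (fun z ↦ h z + (g x - h x)) := by
    refine Complex.isCoveringMap_exp.eqOn_of_comp_eqOn hS hg
      (hh.add continuousOn_const) (fun z hz ↦ Subtype.ext ?_) hx (by ring)
    simp only [Function.comp_apply, Complex.exp_add, Complex.exp_sub, hgh z hz, hgh x hx]
    field_simp [Complex.exp_ne_zero]
  rw [key hy]; ring

/-- The variation of the argument of a nowhere vanishing function whose values stay in a
rotated slit plane. -/
theorem im_sub_im_eq_arg_sub_arg {Y : Type*} [TopologicalSpace Y] {S : Set Y}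
    (hS : IsPreconnected S) {g : Y → ℂ} (hg : ContinuousOn g S) {c : ℂ} (hc : c ≠ 0)
    (hslit : ∀ y ∈ S, Complex.exp (g y) / c ∈ Complex.slitPlane) {x y : Y} (hx : x ∈ S)
    (hy : y ∈ S) :
    (g y).im - (g x).im = (Complex.exp (g y) / c).arg - (Complex.exp (g x) / c).arg := by
  have := sub_eq_sub_of_exp_eq hS hg (h := fun z ↦ Complex.log (Complex.exp (g z) / c)) (c := c)
    (ContinuousOn.clog (by fun_prop) hslit)
    (fun z _ ↦ by
      rw [Complex.exp_log (div_ne_zero (Complex.exp_ne_zero _) hc), mul_div_cancel₀ _ hc]) hx hy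
  simpa only [Complex.sub_im, Complex.log_im] using congrArg Complex.im this

theorem arg_one_sub_exp_mul_I {θ : ℝ} (h0 : 0 < θ) (h1 : θ < 2 * Real.pi) :
    (1 - Complex.exp (θ * Complex.I)).arg = (θ - Real.pi) / 2 := by
  have hs : 0 < 2 * Real.sin (θ / 2) :=
    mul_pos two_pos (Real.sin_pos_of_pos_of_lt_pi (by linarith) (by linarith))
  have : 1 - Complex.exp (θ * Complex.I) = (2 * Real.sin (θ / 2) : ℝ) *
      (Complex.cos ((θ - Real.pi) / 2 : ℝ) + Complex.sin ((θ - Real.pi) / 2 : ℝ) * Complex.I) := by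
    have h1 : Real.cos ((θ - Real.pi) / 2) = Real.sin (θ / 2) := by
      rw [sub_div, Real.cos_sub_pi_div_two]
    have h2 : Real.sin ((θ - Real.pi) / 2) = -Real.cos (θ / 2) := by
      rw [sub_div, Real.sin_sub_pi_div_two]
    have h3 : Real.cos θ = 1 - 2 * Real.sin (θ / 2) ^ 2 := by
      have := Real.cos_sq' (θ / 2)
      have h := Real.cos_two_mul (θ / 2)
      rw [mul_div_cancel₀ _ two_ne_zero] at h; linarith
    have h4 : Real.sin θ = 2 * Real.sin (θ / 2) * Real.cos (θ / 2) := by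
      rw [← Real.sin_two_mul, mul_div_cancel₀ _ two_ne_zero]
    rw [Complex.exp_mul_I, ← Complex.ofReal_cos, ← Complex.ofReal_sin, ← Complex.ofReal_cos,
      ← Complex.ofReal_sin, h1, h2, h3, h4]
    push_cast; ring
  rw [this, Complex.arg_mul_cos_add_sin_mul_I hs ⟨by linarith, by linarith⟩]

theorem one_sub_mem_slitPlane {w : ℂ} (hw : ‖w‖ ≤ 1) (h : w ≠ 1) :
    1 - w ∈ Complex.slitPlane := by
  left
  have h1 := (Complex.re_le_norm w).trans hw
  rw [Complex.sub_re, Complex.one_re, sub_pos]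
  refine h1.lt_of_ne fun hre ↦ h (Complex.ext hre ?_)
  have h2 : w.re ^ 2 + w.im ^ 2 ≤ 1 := by
    have := Complex.sq_norm w
    rw [Complex.normSq_apply] at this
    nlinarith [norm_nonneg w]
  rw [hre] at h2
  simp only [Complex.one_im]
  nlinarith

/-- Two paths in the closed unit disc whose endpoints are linked on the unit circle meet. -/
theorem exists_eq_of_linked_paths {a b c d : ℝ} (hab : a < b) (hbc : b < c) (hcd : c < d)
    (hda : d < a + 2 * Real.pi)
    (γ : Path (Complex.exp (a * Complex.I)) (Complex.exp (c * Complex.I)))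
    (δ : Path (Complex.exp (b * Complex.I)) (Complex.exp (d * Complex.I)))
    (hγ : ∀ t, ‖γ t‖ ≤ 1) (hδ : ∀ t, ‖δ t‖ ≤ 1) : ∃ s t, γ s = δ t := by
  by_contra! hne
  let F : C(unitInterval × unitInterval, ℂ) := ⟨fun q ↦ γ q.1 - δ q.2, by fun_prop⟩
  have hF : ∀ q, F q ≠ 0 := fun q ↦ sub_ne_zero.2 (hne _ _)
  have : ContractibleSpace unitInterval := (convex_Icc (0 : ℝ) 1).contractibleSpace (by simp)
  have : LocallyPathConnectedSpace unitInterval := (convex_Icc (0 : ℝ) 1).locallyPathConnectedSpace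
  obtain ⟨G, ⟨-, hG⟩, -⟩ := Complex.isCoveringMapOn_exp.existsUnique_continuousMap_lifts F
    (Complex.exp_log (hF (0, 0))) hF
  replace hG : ∀ s t, Complex.exp (G (s, t)) = γ s - δ t := fun s t ↦ congrFun hG (s, t)
  have edge : ∀ (θ φ ψ : ℝ) (σ : ℂ) (p : unitInterval → unitInterval × unitInterval)
      (w : unitInterval → ℂ), σ ≠ 0 → Continuous p → (∀ t, ‖w t‖ ≤ 1) →
      (∀ t, Complex.exp (G (p t)) = σ * (Complex.exp (θ * Complex.I) - w t)) →
      w 0 = Complex.exp (φ * Complex.I) → w 1 = Complex.exp (ψ * Complex.I) →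
      (G (p 1)).im - (G (p 0)).im = (1 - Complex.exp ((ψ - θ : ℝ) * Complex.I)).arg -
        (1 - Complex.exp ((φ - θ : ℝ) * Complex.I)).arg := by
    intro θ φ ψ σ p w hσ hp hw hGp h0 h1
    have hc : σ * Complex.exp (θ * Complex.I) ≠ 0 := mul_ne_zero hσ (Complex.exp_ne_zero _)
    have hdiv : ∀ t, Complex.exp (G (p t)) / (σ * Complex.exp (θ * Complex.I)) =
        1 - w t / Complex.exp (θ * Complex.I) := fun t ↦ by
      rw [hGp, mul_div_mul_left _ _ hσ, sub_div, div_self (Complex.exp_ne_zero _)]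
    have := im_sub_im_eq_arg_sub_arg (g := fun t ↦ G (p t)) isPreconnected_univ
      (by fun_prop) hc (fun t _ ↦ by
        rw [hdiv]
        refine one_sub_mem_slitPlane ?_ fun h ↦ ?_
        · rw [norm_div, Complex.norm_exp_ofReal_mul_I, div_one]; exact hw t
        · rw [div_eq_one_iff_eq (Complex.exp_ne_zero _)] at h
          exact Complex.exp_ne_zero (G (p t)) (by rw [hGp, h, sub_self, mul_zero]))
      (mem_univ (0 : unitInterval)) (mem_univ 1)
    rw [this, hdiv, hdiv, h0, h1, ← Complex.exp_sub, ← Complex.exp_sub]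
    push_cast
    simp only [sub_mul]
  have e1 := edge a b d 1 (fun t ↦ (0, t)) δ one_ne_zero (by fun_prop) hδ
    (fun t ↦ by simp [hG]) (by simp) (by simp)
  have e2 := edge d a c (-1) (fun t ↦ (t, 1)) γ (by simp) (by fun_prop) hγ
    (fun t ↦ by simp [hG]) (by simp) (by simp)
  have e3 := edge c b d 1 (fun t ↦ (1, t)) δ one_ne_zero (by fun_prop) hδ
    (fun t ↦ by simp [hG]) (by simp) (by simp)
  have e4 := edge b a c (-1) (fun t ↦ (t, 0)) γ (by simp) (by fun_prop) hγ
    (fun t ↦ by simp [hG]) (by simp) (by simp)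
  have per : ∀ {θ : ℝ}, -(2 * Real.pi) < θ → θ < 0 →
      (1 - Complex.exp (θ * Complex.I)).arg = (θ + Real.pi) / 2 := fun {θ} h1 h2 ↦ by
    have := arg_one_sub_exp_mul_I (θ := θ + 2 * Real.pi) (by linarith) (by linarith)
    push_cast at this
    rw [add_mul, Complex.exp_periodic] at this
    rw [this]; ring
  rw [arg_one_sub_exp_mul_I (by linarith) (by linarith),
    arg_one_sub_exp_mul_I (by linarith) (by linarith)] at e1
  rw [per (by linarith) (by linarith), per (by linarith) (by linarith)] at e2
  rw [arg_one_sub_exp_mul_I (by linarith) (by linarith), per (by linarith) (by linarith)] at e3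
  rw [arg_one_sub_exp_mul_I (by linarith) (by linarith), per (by linarith) (by linarith)] at e4
  linarith [Real.pi_pos]

/-- A simply connected, locally path-connected normal space is unicoherent. -/
theorem isPreconnected_inter_of_union_eq_univ {X : Type*} [TopologicalSpace X]
    [NormalSpace X] [SimplyConnectedSpace X] [LocallyPathConnectedSpace X] {A B : Set X}
    (hA : IsPreconnected A) (hB : IsPreconnected B) (hAc : IsClosed A) (hBc : IsClosed B)
    (hAB : A ∪ B = univ) : IsPreconnected (A ∩ B) := by
  classical
  rw [isPreconnected_iff_subset_of_fully_disjoint_closed (hAc.inter hBc)]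
  intro u v hu hv huv hdisj
  by_contra! hcon
  obtain ⟨⟨y, hy, hyu⟩, x, hx, hxv⟩ := hcon.imp not_subset.1 not_subset.1
  have hxu : x ∈ u := (huv hx).resolve_right hxv
  have hyv : y ∈ v := (huv hy).resolve_left hyu
  obtain ⟨f, hf0, hf1, -⟩ := exists_continuous_zero_one_of_isClosed hu hv hdisj
  let φ : X → ℂ := fun z ↦ Real.pi * f z * Complex.I
  have hφ : Continuous φ := by fun_prop
  have hφ0 : φ x = 0 := by simp [φ, hf0 hxu]
  have hφ1 : φ y = Real.pi * Complex.I := by simp [φ, hf1 hyv]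
  let k : X → ℂ := fun z ↦ if z ∈ A then Complex.exp (φ z) else Complex.exp (-φ z)
  have hkA : ∀ z ∈ A, k z = Complex.exp (φ z) := fun z hz ↦ if_pos hz
  have hkB : ∀ z ∈ B, k z = Complex.exp (-φ z) := fun z hz ↦ by
    by_cases hzA : z ∈ A
    · rw [hkA z hzA]
      rcases huv ⟨hzA, hz⟩ with h | h
      · simp [φ, hf0 h]
      · simp [φ, hf1 h, Complex.exp_neg]
    · exact if_neg hzA
  have hk : Continuous k := by
    rw [← continuousOn_univ, ← hAB]
    exact ContinuousOn.union_of_isClosed (hφ.cexp.continuousOn.congr hkA)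
      (hφ.neg.cexp.continuousOn.congr hkB) hAc hBc
  have hk0 : ∀ z, k z ≠ 0 := fun z ↦ by
    simp only [k]; split_ifs <;> exact Complex.exp_ne_zero _
  obtain ⟨G, ⟨-, hG⟩, -⟩ := Complex.isCoveringMapOn_exp.existsUnique_continuousMap_lifts ⟨k, hk⟩
    (Complex.exp_log (hk0 x)) hk0
  replace hG : ∀ z, Complex.exp (G z) = k z := fun z ↦ congrFun hG z
  have h1 := sub_eq_sub_of_exp_eq hA G.continuous.continuousOn hφ.continuousOn (c := 1)
    (fun z hz ↦ by rw [hG, hkA z hz, one_mul]) hx.1 hy.1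
  have h2 := sub_eq_sub_of_exp_eq hB G.continuous.continuousOn (h := fun z ↦ -φ z)
    hφ.neg.continuousOn (c := 1)
    (fun z hz ↦ by rw [hG, hkB z hz, one_mul]) hx.2 hy.2
  simp only [h1, hφ0, hφ1] at h2
  have := congrArg Complex.im h2
  simp at this
  linarith [Real.pi_pos]

theorem isClosed_connectedComponentIn {X : Type*} [TopologicalSpace X] {F : Set X}
    (hF : IsClosed F) (x : X) : IsClosed (connectedComponentIn F x) := by
  by_cases hx : x ∈ F
  · refine isClosed_of_closure_subset ?_
    exact isPreconnected_connectedComponentIn.closure.subset_connectedComponentIn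
      (subset_closure (mem_connectedComponentIn hx))
      (closure_minimal (connectedComponentIn_subset _ _) hF)
  · rw [connectedComponentIn_eq_empty hx]
    exact isClosed_empty

/-- In a connected space, the complement of a component of the complement of a connected open set is
connected. -/
theorem isPreconnected_compl_connectedComponentIn_compl {X : Type*} [TopologicalSpace X]
    [PreconnectedSpace X] {U : Set X} (hU : IsPreconnected U) (hUo : IsOpen U)
    {x : X} (hx : x ∈ Uᶜ) : IsPreconnected (connectedComponentIn Uᶜ x)ᶜ := by
  set C := connectedComponentIn Uᶜ x
  have hCc : IsClosed C := isClosed_connectedComponentIn hUo.isClosed_compl x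
  have hCU : U ⊆ Cᶜ := subset_compl_comm.1 (connectedComponentIn_subset _ _)
  have main : ∀ M N : Set X, IsOpen M → IsOpen N → Cᶜ ⊆ M ∪ N → Cᶜ ∩ (M ∩ N) = ∅ →
      U ⊆ M → Cᶜ ⊆ M := by
    intro M N hM hN hMN hdisj hUM
    have hNC : IsPreconnected (C ∪ (Cᶜ ∩ N)) := by
      have hcl : IsClosed (C ∪ (Cᶜ ∩ N)) := by
        have : C ∪ (Cᶜ ∩ N) = (Cᶜ ∩ M)ᶜ := by
          ext z
          have h1 := @hMN z
          have h2 := (eq_empty_iff_forall_notMem.1 hdisj) z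
          simp only [mem_union, mem_inter_iff, mem_compl_iff] at *
          tauto
        rw [this]
        exact (hCc.isOpen_compl.inter hM).isClosed_compl
      have aux : ∀ a b : Set X, IsClosed a → IsClosed b → C ∪ (Cᶜ ∩ N) ⊆ a ∪ b →
          (C ∪ (Cᶜ ∩ N)) ∩ (a ∩ b) = ∅ → C ⊆ a → C ∪ (Cᶜ ∩ N) ⊆ a := by
        intro a b ha hb hab hd hCa
        have hE : (C ∪ (Cᶜ ∩ N)) ∩ b = (Cᶜ ∩ N) ∩ aᶜ := by
          ext z
          have h1 := @hab z
          have h2 := (eq_empty_iff_forall_notMem.1 hd) z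
          have h3 := @hCa z
          simp only [mem_union, mem_inter_iff, mem_compl_iff] at *
          tauto
        have hclopen : IsClopen ((C ∪ (Cᶜ ∩ N)) ∩ b) := by
          refine ⟨hcl.inter hb, ?_⟩
          rw [hE]
          exact (hCc.isOpen_compl.inter hN).inter ha.isOpen_compl
        rcases isClopen_iff.1 hclopen with h | h
        · intro z hz
          exact (hab hz).resolve_right fun hzb ↦ (h ▸ ⟨hz, hzb⟩ : z ∈ (∅ : Set X))
        · have hxE : x ∈ (C ∪ (Cᶜ ∩ N)) ∩ b := h ▸ mem_univ x
          rw [hE] at hxE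
          exact absurd (mem_connectedComponentIn hx) hxE.1.1
      rw [isPreconnected_iff_subset_of_disjoint_closed]
      intro a b ha hb hab hd
      rcases isPreconnected_iff_subset_of_disjoint_closed.1 isPreconnected_connectedComponentIn
        a b ha hb (subset_union_left.trans hab)
        (subset_empty_iff.1 ((inter_subset_inter_left _ subset_union_left).trans hd.subset))
        with h | h
      · exact Or.inl (aux a b ha hb hab hd h)
      · exact Or.inr (aux b a hb ha (union_comm a b ▸ hab) (inter_comm a b ▸ hd) h)
    have hsub : C ∪ (Cᶜ ∩ N) ⊆ C := by
      refine hNC.subset_connectedComponentIn (Or.inl (mem_connectedComponentIn hx)) ?_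
      rintro z (hz | hz) hzU
      · exact hCU hzU hz
      · exact (eq_empty_iff_forall_notMem.1 hdisj) z ⟨hz.1, hUM hzU, hz.2⟩
    intro z hz
    exact (hMN hz).resolve_right fun hzN ↦ hz (hsub (Or.inr ⟨hz, hzN⟩))
  rw [isPreconnected_iff_subset_of_disjoint]
  intro M N hM hN hMN hd
  rcases isPreconnected_iff_subset_of_disjoint.1 hU M N hM hN (hCU.trans hMN)
    (subset_empty_iff.1 ((inter_subset_inter_left _ hCU).trans hd.subset)) with h | h
  · exact Or.inl (main M N hM hN hMN hd h)
  · exact Or.inr (main N M hN hM (union_comm M N ▸ hMN) (inter_comm M N ▸ hd) h)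

/-- In a simply connected, locally path-connected normal space, the frontier of a component of the
complement of a connected open set is connected. -/
theorem isPreconnected_frontier_connectedComponentIn_compl {X : Type*} [TopologicalSpace X]
    [NormalSpace X] [SimplyConnectedSpace X] [LocallyPathConnectedSpace X] {U : Set X}
    (hU : IsPreconnected U) (hUo : IsOpen U) {x : X} (hx : x ∈ Uᶜ) :
    IsPreconnected (frontier (connectedComponentIn Uᶜ x)) := by
  have hCc : IsClosed (connectedComponentIn Uᶜ x) := isClosed_connectedComponentIn hUo.isClosed_compl x
  rw [frontier_eq_closure_inter_closure, hCc.closure_eq]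
  refine isPreconnected_inter_of_union_eq_univ isPreconnected_connectedComponentIn
    (isPreconnected_compl_connectedComponentIn_compl hU hUo hx).closure hCc isClosed_closure ?_
  exact univ_subset_iff.1 ((union_compl_self _).symm.subset.trans
    (union_subset_union_right _ subset_closure))

/-- The frontier of a component of the complement of an open set lies in the boundary of that
set. -/
theorem frontier_connectedComponentIn_compl_subset {X : Type*} [TopologicalSpace X]
    [LocallyConnectedSpace X] {U : Set X} (hUo : IsOpen U) (x : X) :
    frontier (connectedComponentIn Uᶜ x) ⊆ closure U \ U := by
  have hCc : IsClosed (connectedComponentIn Uᶜ x) := isClosed_connectedComponentIn hUo.isClosed_compl x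
  intro z hz
  have hzC := hCc.frontier_subset hz
  have hzU := connectedComponentIn_subset _ _ hzC
  refine ⟨by_contra fun hcl ↦ hz.2 ?_, hzU⟩
  rw [connectedComponentIn_eq hzC, mem_interior_iff_mem_nhds]
  refine connectedComponentIn_mem_nhds (Filter.mem_of_superset
    (isClosed_closure.isOpen_compl.mem_nhds hcl) (compl_subset_compl.2 subset_closure))

/-- The inclusion of the unit circle in the closed unit disc. -/
def circleToDisc (z : Circle) : Metric.closedBall (0 : ℂ) 1 :=
  ⟨z, mem_closedBall_zero_iff.2 z.norm_coe.le⟩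

theorem isEmbedding_circleToDisc : IsEmbedding circleToDisc :=
  IsEmbedding.subtypeVal.codRestrict _ _

/-- In a locally path-connected space, two points of a connected subset of an open set are joined
by a path in that open set. -/
theorem joinedIn_of_isPreconnected {X : Type*} [TopologicalSpace X]
    [LocallyPathConnectedSpace X] {S W : Set X} (hS : IsPreconnected S) (hW : IsOpen W)
    (hSW : S ⊆ W) {x y : X} (hx : x ∈ S) (hy : y ∈ S) : JoinedIn W x y := by
  have hconn : IsConnected (connectedComponentIn W x) :=
    isConnected_connectedComponentIn_iff.2 (hSW hx)
  exact ((hW.connectedComponentIn.isConnected_iff_isPathConnected.1 hconn).joinedIn x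
    (mem_connectedComponentIn (hSW hx)) y (hS.subset_connectedComponentIn hx hSW hy)).mono
    (connectedComponentIn_subset _ _)

/-- Disjoint connected subsets of the closed unit disc, one of them open, cannot contain linked
pairs of points of the unit circle. -/
theorem not_disjoint_of_linked {U C : Set (Metric.closedBall (0 : ℂ) 1)} (hU : IsPreconnected U)
    (hUo : IsOpen U) (hC : IsPreconnected C) {a b c d : ℝ} (hab : a < b) (hbc : b < c)
    (hcd : c < d) (hda : d < a + 2 * Real.pi) (ha : circleToDisc (Circle.exp a) ∈ U)
    (hb : circleToDisc (Circle.exp b) ∈ C) (hc : circleToDisc (Circle.exp c) ∈ U)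
    (hd : circleToDisc (Circle.exp d) ∈ C) : ¬ Disjoint U C := by
  intro hdisj
  have : LocallyPathConnectedSpace (Metric.closedBall (0 : ℂ) 1) :=
    (convex_closedBall (0 : ℂ) 1).locallyPathConnectedSpace
  obtain ⟨γ, hγ⟩ := joinedIn_of_isPreconnected hU hUo Subset.rfl ha hc
  obtain ⟨δ, hδ⟩ := joinedIn_of_isPreconnected hC
    (isCompact_range γ.continuous).isClosed.isOpen_compl
    (by rintro z hz ⟨t, rfl⟩; exact disjoint_left.1 hdisj (hγ t) hz) hb hd
  obtain ⟨s, t, hst⟩ := exists_eq_of_linked_paths hab hbc hcd hda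
    ((γ.map continuous_subtype_val).cast (Circle.coe_exp a).symm (Circle.coe_exp c).symm)
    ((δ.map continuous_subtype_val).cast (Circle.coe_exp b).symm (Circle.coe_exp d).symm)
    (fun t ↦ mem_closedBall_zero_iff.1 (γ t).2) (fun t ↦ mem_closedBall_zero_iff.1 (δ t).2)
  exact hδ t ⟨s, Subtype.ext hst⟩

theorem exists_mem_Ioo_exp_mem {V : Set Circle} {x a b : ℝ} (hx : Circle.exp x ∈ closure V)
    (hax : a < x) (hxb : x < b) : ∃ y ∈ Ioo a b, Circle.exp y ∈ V := by
  have hopen : IsOpen (Circle.exp '' Ioo a b) :=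
    isLocalHomeomorph_circleExp.isOpenMap _ isOpen_Ioo
  obtain ⟨_, ⟨y, hy, rfl⟩, hyV⟩ :=
    mem_closure_iff.1 hx _ hopen (mem_image_of_mem _ ⟨hax, hxb⟩)
  exact ⟨y, hy, hyV⟩

/-- If a connected open subset `U` of the closed unit disc misses an arc of the unit circle whose
endpoints are limits of points of `U` on the circle, then some connected subset of `closure U \ U`
contains both endpoints and misses the complementary open arc. -/
theorem exists_isConnected_subset_closure_diff_disc {U : Set (Metric.closedBall (0 : ℂ) 1)}
    (hUo : IsOpen U) (hU : IsPreconnected U) {a c : ℝ} (hac : a < c)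
    (ha : Circle.exp a ∈ closure (circleToDisc ⁻¹' U))
    (hc : Circle.exp c ∈ closure (circleToDisc ⁻¹' U))
    (harc : ∀ θ ∈ Icc a c, circleToDisc (Circle.exp θ) ∉ U) :
    ∃ T ⊆ closure U \ U, IsConnected T ∧ circleToDisc (Circle.exp a) ∈ T ∧
      circleToDisc (Circle.exp c) ∈ T ∧
      ∀ θ ∈ Ioo c (a + 2 * Real.pi), circleToDisc (Circle.exp θ) ∉ T := by
  have hconv := convex_closedBall (0 : ℂ) 1
  have : LocallyPathConnectedSpace (Metric.closedBall (0 : ℂ) 1) :=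
    hconv.locallyPathConnectedSpace
  have : ContractibleSpace (Metric.closedBall (0 : ℂ) 1) := hconv.contractibleSpace (by simp)
  have hι := isEmbedding_circleToDisc.continuous
  set C := connectedComponentIn Uᶜ (circleToDisc (Circle.exp a))
  have hCU : Disjoint U C :=
    (subset_compl_iff_disjoint_left.1 (connectedComponentIn_subset _ _))
  have hCc : IsClosed C := isClosed_connectedComponentIn hUo.isClosed_compl _
  have harcC : ∀ θ ∈ Icc a c, circleToDisc (Circle.exp θ) ∈ C := fun θ hθ ↦
    (isPreconnected_Icc.image (fun θ ↦ circleToDisc (Circle.exp θ))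
      (by fun_prop)).subset_connectedComponentIn (mem_image_of_mem _ (left_mem_Icc.2 hac.le))
      (by rintro _ ⟨θ, hθ, rfl⟩; exact harc θ hθ) (mem_image_of_mem _ hθ)
  have hend : ∀ θ ∈ Icc a c, Circle.exp θ ∈ closure (circleToDisc ⁻¹' U) →
      circleToDisc (Circle.exp θ) ∈ frontier C := by
    intro θ hθ hcl
    refine ⟨subset_closure (harcC θ hθ), fun hint ↦ ?_⟩
    obtain ⟨z, hz, hzU⟩ := mem_closure_iff.1 hcl _ (isOpen_interior.preimage hι) hint
    exact disjoint_left.1 hCU hzU (interior_subset hz)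
  have haT := hend a (left_mem_Icc.2 hac.le) ha
  have hcT := hend c (right_mem_Icc.2 hac.le) hc
  refine ⟨frontier C, frontier_connectedComponentIn_compl_subset hUo _, ⟨⟨_, haT⟩,
    isPreconnected_frontier_connectedComponentIn_compl hU hUo
      (harc a (left_mem_Icc.2 hac.le))⟩, haT, hcT, fun ξ hξ hξT ↦ ?_⟩
  obtain ⟨α, hα, hαU⟩ := exists_mem_Ioo_exp_mem (a := ξ - 2 * Real.pi) (b := (a + c) / 2) ha
    (by linarith [hξ.2]) (by linarith)
  obtain ⟨κ, hκ, hκU⟩ := exists_mem_Ioo_exp_mem (a := (a + c) / 2) (b := ξ) hc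
    (by linarith) hξ.1
  exact not_disjoint_of_linked hU hUo isPreconnected_connectedComponentIn hα.2 hκ.1 hκ.2
    (by linarith [hα.1]) hαU (harcC _ ⟨by linarith, by linarith⟩) hκU
    (hCc.frontier_subset hξT) hCU

theorem exists_homeomorph_unitSquare_disc : ∃ H : (ℝ × ℝ) ≃ₜ ℂ,
    H '' unitSquare = Metric.closedBall 0 1 ∧ H '' frontier unitSquare = Metric.sphere 0 1 := by
  let L : (ℝ × ℝ) ≃L[ℝ] ℂ := Complex.equivRealProdCLM.symm
  have hconv : Convex ℝ unitSquare := (convex_Icc 0 1).prod (convex_Icc 0 1)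
  have hclosed : IsClosed unitSquare := isClosed_Icc.prod isClosed_Icc
  have hcpt : IsCompact unitSquare := isCompact_Icc.prod isCompact_Icc
  have hint : (interior unitSquare).Nonempty := by
    rw [unitSquare, interior_prod_eq, interior_Icc]
    exact ⟨(1 / 2, 1 / 2), by norm_num⟩
  obtain ⟨h, -, h2, h3⟩ := exists_homeomorph_image_interior_closure_frontier_eq_unitBall
    (s := L '' unitSquare) (hconv.linear_image L.toLinearMap)
    (by
      have := L.toHomeomorph.image_interior unitSquare
      exact (this ▸ hint.image _ : (interior (L.toHomeomorph '' unitSquare)).Nonempty))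
    (hcpt.image L.continuous).isBounded
  refine ⟨L.toHomeomorph.trans h, ?_, ?_⟩
  · rw [← h2, (hcpt.image L.continuous).isClosed.closure_eq, image_image]
    rfl
  · have := L.toHomeomorph.image_frontier unitSquare
    rw [← h3]
    change _ = h '' frontier (L.toHomeomorph '' unitSquare)
    rw [← this, image_image]
    rfl

/-- The closed unit disc parametrizes the unit square, the unit circle corresponding to the
boundary of the square. -/
theorem exists_disc_param : ∃ e : Metric.closedBall (0 : ℂ) 1 → ℝ × ℝ, IsEmbedding e ∧
    range e = unitSquare ∧ range (e ∘ circleToDisc) = frontier unitSquare := by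
  obtain ⟨H, h1, h2⟩ := exists_homeomorph_unitSquare_disc
  refine ⟨fun z ↦ H.symm z, H.symm.isEmbedding.comp IsEmbedding.subtypeVal, ?_, ?_⟩
  · rw [range_comp' H.symm Subtype.val, Subtype.range_coe, ← h1, ← image_comp]
    simp
  · ext p
    rw [← H.injective.mem_set_image (s := frontier unitSquare), h2]
    constructor
    · rintro ⟨z, rfl⟩
      simp [circleToDisc, z.norm_coe]
    · exact fun hp ↦ ⟨⟨H p, hp⟩, H.symm_apply_apply p⟩

theorem exists_mem_Ico_exp_eq (a : ℝ) (z : Circle) :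
    ∃ θ ∈ Ico a (a + 2 * Real.pi), Circle.exp θ = z := by
  obtain ⟨t, rfl⟩ := Circle.exp_surjective z
  obtain ⟨θ, hθ, h⟩ := Circle.periodic_exp.exists_mem_Ico Real.two_pi_pos t a
  exact ⟨θ, hθ, h.symm⟩

/-- The statement about the square, when the arc of `∂I²` disjoint from `U` is the image of an
interval of angles `(a, c)`. -/
theorem exists_isConnected_of_arc_subset {U : Set (ℝ × ℝ)} (hUsub : U ⊆ unitSquare)
    (hUopen : ∃ O : Set (ℝ × ℝ), IsOpen O ∧ U = O ∩ unitSquare) (hUconn : IsPreconnected U)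
    {e : Metric.closedBall (0 : ℂ) 1 → ℝ × ℝ} (he : IsEmbedding e) (hes : range e = unitSquare)
    (hef : range (e ∘ circleToDisc) = frontier unitSquare) {a c : ℝ} (hac : a < c)
    (ha : e (circleToDisc (Circle.exp a)) ∈ closure (U ∩ frontier unitSquare))
    (hc : e (circleToDisc (Circle.exp c)) ∈ closure (U ∩ frontier unitSquare))
    (harc : ∀ θ ∈ Icc a c, e (circleToDisc (Circle.exp θ)) ∉ U) :
    ∃ T ⊆ frontier U, IsConnected T ∧ e (circleToDisc (Circle.exp a)) ∈ T ∧
      e (circleToDisc (Circle.exp c)) ∈ T ∧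
      ∀ θ ∈ Ioo c (a + 2 * Real.pi), e (circleToDisc (Circle.exp θ)) ∉ T := by
  have hec := he.comp isEmbedding_circleToDisc
  have hcl : ∀ z : Circle, e (circleToDisc z) ∈ closure (U ∩ frontier unitSquare) →
      z ∈ closure (circleToDisc ⁻¹' (e ⁻¹' U)) := fun z hz ↦ by
    rw [← preimage_comp, hec.isInducing.closure_eq_preimage_closure_image,
      image_preimage_eq_inter_range, hef]
    exact hz
  have hUo : IsOpen (e ⁻¹' U) := by
    obtain ⟨O, hO, rfl⟩ := hUopen
    rw [← hes, preimage_inter_range]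
    exact hO.preimage he.continuous
  have hUp : IsPreconnected (e ⁻¹' U) := by
    rw [← he.isInducing.isPreconnected_image, image_preimage_eq_of_subset (hes ▸ hUsub)]
    exact hUconn
  obtain ⟨T, hTU, hT, haT, hcT, hTarc⟩ := exists_isConnected_subset_closure_diff_disc hUo hUp hac
    (hcl _ ha) (hcl _ hc) harc
  refine ⟨e '' T, ?_, hT.image e he.continuous.continuousOn, mem_image_of_mem e haT,
    mem_image_of_mem e hcT, fun θ hθ h ↦ hTarc θ hθ (he.injective.mem_set_image.1 h)⟩
  rintro _ ⟨z, hz, rfl⟩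
  have hz' := hTU hz
  exact ⟨closure_mono (image_preimage_subset e U)
    (image_closure_subset_closure_image he.continuous (mem_image_of_mem e hz'.1)),
    fun h ↦ hz'.2 (interior_subset h : e z ∈ U)⟩

/-- Let `U ⊆ I²` be connected, open in the subspace topology of `I²`, and intersecting
`∂I²`.  Let `P ≠ Q` be points of the boundary, taken inside `∂I²`, of `U ∩ ∂I²`
(for `A ⊆ ∂I²` with `∂I²` closed in `ℝ²`, this boundary is `closure A ∩ closure (∂I² \ A)`),
and let `B`, `B'` be the two connected components of `∂I² − {P, Q}`.  If `B ∩ U = ∅`,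
then some connected subset of `∂U − (B' ∩ ∂U)` contains both `P` and `Q`. -/
theorem connected_boundary_piece (U : Set (ℝ × ℝ)) (hUsub : U ⊆ unitSquare)
    (hUopen : ∃ O : Set (ℝ × ℝ), IsOpen O ∧ U = O ∩ unitSquare)
    (hUconn : IsPreconnected U) (hUmeets : (U ∩ frontier unitSquare).Nonempty)
    (P Q : ℝ × ℝ) (hPQ : P ≠ Q)
    (hP : P ∈ closure (U ∩ frontier unitSquare) ∩
      closure (frontier unitSquare \ U))
    (hQ : Q ∈ closure (U ∩ frontier unitSquare) ∩
      closure (frontier unitSquare \ U))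
    (B B' : Set (ℝ × ℝ))
    (hB : ∃ x ∈ frontier unitSquare \ {P, Q},
      B = connectedComponentIn (frontier unitSquare \ {P, Q}) x)
    (hB' : ∃ x ∈ frontier unitSquare \ {P, Q},
      B' = connectedComponentIn (frontier unitSquare \ {P, Q}) x)
    (hBB' : B ∪ B' = frontier unitSquare \ {P, Q})
    (hBU : B ∩ U = ∅) :
    ∃ T : Set (ℝ × ℝ), T ⊆ frontier U \ (B' ∩ frontier U) ∧
      IsConnected T ∧ P ∈ T ∧ Q ∈ T := by
  obtain ⟨e, he, hes, hef⟩ := exists_disc_param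
  have hsq : frontier unitSquare ⊆ unitSquare :=
    (isClosed_Icc.prod isClosed_Icc).frontier_subset
  have hnot : ∀ R ∈ closure (frontier unitSquare \ U), R ∉ U := by
    intro R hR hRU
    obtain ⟨O, hO, rfl⟩ := hUopen
    obtain ⟨z, hzO, hz, hzU⟩ := mem_closure_iff.1 hR O hO hRU.1
    exact hzU ⟨hzO, hsq hz⟩
  have hPU := hnot P hP.2
  have hQU := hnot Q hQ.2
  have hmem : ∀ z : Circle, e (circleToDisc z) ∈ frontier unitSquare := fun z ↦
    hef ▸ mem_range_self z
  have hinj : Function.Injective (e ∘ circleToDisc) :=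
    (he.comp isEmbedding_circleToDisc).injective
  have hBne : ∀ y ∈ B, y ∉ B' := by
    intro y hy hy'
    have hBeq : B = B' := by
      obtain ⟨x, -, rfl⟩ := hB
      obtain ⟨x', -, rfl⟩ := hB'
      rw [connectedComponentIn_eq hy, connectedComponentIn_eq hy']
    obtain ⟨u, hu, hu'⟩ := hUmeets
    have huB : u ∈ B := by
      rw [← union_self B]
      nth_rw 2 [hBeq]
      rw [hBB']
      refine ⟨hu', ?_⟩
      rintro (rfl | rfl) <;> contradiction
    exact (hBU ▸ ⟨huB, hu⟩ : u ∈ (∅ : Set _))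
  have main : ∀ a c : ℝ, a < c → c < a + 2 * Real.pi →
      ({P, Q} : Set (ℝ × ℝ)) =
        {e (circleToDisc (Circle.exp a)), e (circleToDisc (Circle.exp c))} →
      (∃ θ ∈ Ioo a c, e (circleToDisc (Circle.exp θ)) ∈ B) →
      ∃ T : Set (ℝ × ℝ), T ⊆ frontier U \ (B' ∩ frontier U) ∧
        IsConnected T ∧ P ∈ T ∧ Q ∈ T := by
    rintro a c hac hca hpair ⟨θ₀, hθ₀, hθB⟩
    have hsub : ∀ (p : ℝ × ℝ → Prop), p P → p Q →
        p (e (circleToDisc (Circle.exp a))) ∧ p (e (circleToDisc (Circle.exp c))) := by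
      intro p hp hq
      have h : ∀ z ∈ ({P, Q} : Set (ℝ × ℝ)), p z := by rintro z (rfl | rfl) <;> assumption
      rw [hpair] at h
      exact ⟨h _ (Or.inl rfl), h _ (Or.inr rfl)⟩
    have harcB : ∀ θ ∈ Ioo a c, e (circleToDisc (Circle.exp θ)) ∈ B := by
      intro θ hθ
      obtain ⟨x, hx, rfl⟩ := hB
      rw [connectedComponentIn_eq hθB]
      refine (isPreconnected_Ioo.image (fun θ ↦ e (circleToDisc (Circle.exp θ)))
        (he.continuous.comp (isEmbedding_circleToDisc.continuous.comp
          Circle.exp.continuous)).continuousOn).subset_connectedComponentIn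
          (mem_image_of_mem _ hθ₀) ?_ (mem_image_of_mem _ hθ)
      rintro _ ⟨t, ht, rfl⟩
      refine ⟨hmem _, fun h ↦ ?_⟩
      have hi := Circle.exp_injOn_Ico (a := a) (b := a + 2 * Real.pi) (by linarith)
      have ht' : t ∈ Ico a (a + 2 * Real.pi) := ⟨ht.1.le, ht.2.trans hca⟩
      rw [hpair] at h
      rcases h with h | h
      · exact ht.1.ne' (hi ht' ⟨le_rfl, by linarith⟩ (hinj h))
      · exact ht.2.ne (hi ht' ⟨hac.le, hca⟩ (hinj h))
    obtain ⟨haU, hcU⟩ := hsub (· ∉ U) hPU hQU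
    obtain ⟨haV, hcV⟩ := hsub (· ∈ closure (U ∩ frontier unitSquare)) hP.1 hQ.1
    obtain ⟨T, hTU, hT, haT, hcT, hTarc⟩ := exists_isConnected_of_arc_subset hUsub hUopen hUconn
      he hes hef hac haV hcV (fun θ hθ hU ↦ by
        rcases hθ.1.eq_or_lt with rfl | h1
        · exact haU hU
        rcases hθ.2.eq_or_lt with rfl | h2
        · exact hcU hU
        exact (hBU ▸ ⟨harcB θ ⟨h1, h2⟩, hU⟩ : e (circleToDisc (Circle.exp θ)) ∈ (∅ : Set _)))
    have hPQT : ∀ z ∈ ({P, Q} : Set (ℝ × ℝ)), z ∈ T := by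
      rw [hpair]
      rintro z (rfl | rfl) <;> assumption
    refine ⟨T, fun y hy ↦ ⟨hTU hy, fun ⟨hyB', _⟩ ↦ ?_⟩, hT, hPQT _ (Or.inl rfl),
      hPQT _ (Or.inr rfl)⟩
    have hy' : y ∈ frontier unitSquare \ {P, Q} := hBB' ▸ Or.inr hyB'
    rw [hpair, ← hef] at hy'
    obtain ⟨⟨z, rfl⟩, hyPQ⟩ := hy'
    obtain ⟨θ, hθ, rfl⟩ := exists_mem_Ico_exp_eq a z
    rcases hθ.1.eq_or_lt with rfl | h1
    · exact hyPQ (Or.inl rfl)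
    rcases lt_trichotomy θ c with h2 | rfl | h2
    · exact hBne _ (harcB θ ⟨h1, h2⟩) hyB'
    · exact hyPQ (Or.inr rfl)
    · exact hTarc θ ⟨h2, hθ.2⟩ hy
  have hfr : IsClosed (frontier unitSquare) := isClosed_frontier
  have hPf : P ∈ range (e ∘ circleToDisc) :=
    hef ▸ closure_minimal inter_subset_right hfr hP.1
  have hQf : Q ∈ range (e ∘ circleToDisc) :=
    hef ▸ closure_minimal inter_subset_right hfr hQ.1
  obtain ⟨p, rfl⟩ := hPf
  obtain ⟨q, rfl⟩ := hQf
  obtain ⟨x, hx, hBx⟩ := hB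
  have hxB : x ∈ B := hBx ▸ mem_connectedComponentIn hx
  rw [← hef] at hx
  obtain ⟨⟨z, rfl⟩, hxPQ⟩ := hx
  obtain ⟨a, rfl⟩ := Circle.exp_surjective p
  obtain ⟨c, hc, rfl⟩ := exists_mem_Ico_exp_eq a q
  obtain ⟨θ, hθ, rfl⟩ := exists_mem_Ico_exp_eq a z
  have hac : a < c := hc.1.lt_of_ne fun h ↦ hPQ (h ▸ rfl)
  have haθ : a < θ := hθ.1.lt_of_ne fun h ↦ hxPQ (Or.inl (h ▸ rfl))
  rcases lt_trichotomy θ c with h | rfl | h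
  · exact main a c hac hc.2 rfl ⟨θ, ⟨haθ, h⟩, hxB⟩
  · exact absurd (Or.inr rfl) hxPQ
  · refine main c (a + 2 * Real.pi) hc.2 (by linarith) ?_ ⟨θ, ⟨h, hθ.2⟩, hxB⟩
    rw [Circle.periodic_exp, pair_comm]
    rfl
end
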